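/- For every positive integer n and every 2-homogeneous polynomial P(x) = ∑_{|α|=2} a_α x^α on complex ℓ_2^n, one has max_{|α|=2} |a_α| ≤ (4/√π) ‖P‖. -/

import Mathlib

open scoped BigOperators

/-- The `ℓ_p` norm of a vector in `ℂ^n`: `(∑ i, ‖x i‖^p)^(1/p)`. -/
noncomputable def lpNorm (p : ℝ) {n : ℕ} (x : Fin n → ℂ) : ℝ :=
  (∑ i, ‖x i‖ ^ p) ^ (1 / p)

/-- The sup norm of a complex polynomial on the unit ball of `ℓ_p^n`. -/
noncomputable def polyNorm (p : ℝ) {n : ℕ} (P : MvPolynomial (Fin n) ℂ) : ℝ :=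
  sSup {t : ℝ | ∃ x : Fin n → ℂ, lpNorm p x ≤ 1 ∧ t = ‖MvPolynomial.eval x P‖}

theorem lpNorm_two_le_one_iff {n : ℕ} (x : Fin n → ℂ) :
    lpNorm 2 x ≤ 1 ↔ ∑ i, ‖x i‖ ^ 2 ≤ 1 := by
  have h : lpNorm 2 x = Real.sqrt (∑ i, ‖x i‖ ^ 2) := by
    simp [lpNorm, Real.sqrt_eq_rpow]
  rw [h, Real.sqrt_le_one]

theorem norm_eval_le_polyNorm_two {n : ℕ} (P : MvPolynomial (Fin n) ℂ) (x : Fin n → ℂ)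
    (hx : ∑ i, ‖x i‖ ^ 2 ≤ 1) : ‖MvPolynomial.eval x P‖ ≤ polyNorm 2 P := by
  refine le_csSup ⟨∑ d ∈ P.support, ‖P.coeff d‖, ?_⟩ ⟨x, (lpNorm_two_le_one_iff x).2 hx, rfl⟩
  rintro t ⟨y, hy, rfl⟩
  rw [lpNorm_two_le_one_iff] at hy
  have hy1 : ∀ i, ‖y i‖ ≤ 1 := fun i => by
    have : ‖y i‖ ^ 2 ≤ 1 :=
      (Finset.single_le_sum (f := fun i => ‖y i‖ ^ 2) (fun _ _ => by positivity)
        (Finset.mem_univ i)).trans hy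
    nlinarith [norm_nonneg (y i)]
  rw [MvPolynomial.eval_eq']
  refine (norm_sum_le _ _).trans (Finset.sum_le_sum fun d _ => ?_)
  rw [norm_mul, norm_prod]
  refine mul_le_of_le_one_right (norm_nonneg _) (Finset.prod_le_one (fun _ _ => norm_nonneg _) ?_)
  intro i _
  rw [norm_pow]
  exact pow_le_one₀ (norm_nonneg _) (hy1 i)

theorem eval_single_one_of_isHomogeneous {n m : ℕ} {P : MvPolynomial (Fin n) ℂ}
    (hP : P.IsHomogeneous m) (i : Fin n) :
    MvPolynomial.eval (Pi.single i 1) P = P.coeff (Finsupp.single i m) := by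
  rw [MvPolynomial.eval_eq', Finset.sum_eq_single (Finsupp.single i m)]
  · rw [Finset.prod_eq_one, mul_one]
    intro k _
    by_cases hk : k = i
    · subst hk; simp
    · simp [Ne.symm hk]
  · intro d hd hne
    have hdeg : d.degree = m := by
      by_contra h
      exact MvPolynomial.mem_support_iff.1 hd (hP.coeff_eq_zero h)
    obtain ⟨k, hki, hk⟩ : ∃ k, k ≠ i ∧ d k ≠ 0 := by
      by_contra! h
      apply hne
      have hd' : d = Finsupp.single i (d i) := by
        ext k
        by_cases hk : k = i
        · subst hk; simp
        · simp [Ne.symm hk, h k hk]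
      rw [hd', Finsupp.degree_single] at hdeg
      rw [hd', hdeg]
    rw [Finset.prod_eq_zero (Finset.mem_univ k), mul_zero]
    simp [hki, hk]
  · intro h
    simp [MvPolynomial.notMem_support_iff.1 h]

theorem prod_pow_two_point {n : ℕ} {i j : Fin n} (hij : i ≠ j) (s c : ℂ) (d : Fin n →₀ ℕ)
    (h : ∀ k, k ≠ i → k ≠ j → d k = 0) :
    ∏ k, ((Pi.single i s + Pi.single j c : Fin n → ℂ) k) ^ d k = s ^ d i * c ^ d j := by
  rw [← Finset.prod_subset (Finset.subset_univ {i, j}), Finset.prod_pair hij]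
  · simp [hij, hij.symm]
  · intro k _ hk
    simp only [Finset.mem_insert, Finset.mem_singleton, not_or] at hk
    simp [h k hk.1 hk.2]

theorem eval_two_point_sub_eval_two_point {n : ℕ} {P : MvPolynomial (Fin n) ℂ}
    (hP : P.IsHomogeneous 2) {i j : Fin n} (hij : i ≠ j) (s : ℂ) :
    MvPolynomial.eval (Pi.single i s + Pi.single j s) P -
      MvPolynomial.eval (Pi.single i s + Pi.single j (-s)) P =
      2 * s ^ 2 * P.coeff (Finsupp.single i 1 + Finsupp.single j 1) := by
  rw [MvPolynomial.eval_eq', MvPolynomial.eval_eq', ← Finset.sum_sub_distrib,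
    Finset.sum_eq_single (Finsupp.single i 1 + Finsupp.single j 1)]
  · have h : ∀ k, k ≠ i → k ≠ j →
        (Finsupp.single i 1 + Finsupp.single j 1 : Fin n →₀ ℕ) k = 0 := by
      intro k hki hkj
      simp [Ne.symm hki, Ne.symm hkj]
    rw [prod_pow_two_point hij s s _ h, prod_pow_two_point hij s (-s) _ h]
    simp [hij, hij.symm]
    ring
  · intro d hd hne
    by_cases h : ∀ k, k ≠ i → k ≠ j → d k = 0
    · have hdeg : d i + d j = 2 := by
        have hdeg : d.degree = 2 := by
          by_contra h
          exact MvPolynomial.mem_support_iff.1 hd (hP.coeff_eq_zero h)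
        rw [Finsupp.degree_eq_sum, ← Finset.sum_subset (Finset.subset_univ {i, j}),
          Finset.sum_pair hij] at hdeg
        · exact hdeg
        · intro k _ hk
          simp only [Finset.mem_insert, Finset.mem_singleton, not_or] at hk
          exact h k hk.1 hk.2
      have hj : d j ≠ 1 := by
        intro hj
        apply hne
        ext k
        by_cases hki : k = i
        · subst hki; simp [hij]; omega
        · by_cases hkj : k = j
          · subst hkj; simp [hki, hj]
          · simp [Ne.symm hki, Ne.symm hkj, h k hki hkj]
      have hev : Even (d j) := by
        have : d j = 0 ∨ d j = 2 := by omega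
        rcases this with h | h <;> simp [h]
      rw [prod_pow_two_point hij s s _ h, prod_pow_two_point hij s (-s) _ h, hev.neg_pow, sub_self]
    · push Not at h
      obtain ⟨k, hki, hkj, hk⟩ := h
      rw [Finset.prod_eq_zero (Finset.mem_univ k), Finset.prod_eq_zero (Finset.mem_univ k), sub_self]
      all_goals simp [hki, hkj, hk]
  · intro h
    simp [MvPolynomial.notMem_support_iff.1 h]

theorem sum_norm_sq_two_point {n : ℕ} {i j : Fin n} (hij : i ≠ j) (s c : ℂ) :
    ∑ k, ‖(Pi.single i s + Pi.single j c : Fin n → ℂ) k‖ ^ 2 = ‖s‖ ^ 2 + ‖c‖ ^ 2 := by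
  rw [← Finset.sum_subset (Finset.subset_univ {i, j}), Finset.sum_pair hij]
  · simp [hij, hij.symm]
  · intro k _ hk
    simp only [Finset.mem_insert, Finset.mem_singleton, not_or] at hk
    simp [hk.1, hk.2]

theorem norm_coeff_single_le_polyNorm_two {n m : ℕ} {P : MvPolynomial (Fin n) ℂ}
    (hP : P.IsHomogeneous m) (i : Fin n) :
    ‖P.coeff (Finsupp.single i m)‖ ≤ polyNorm 2 P := by
  rw [← eval_single_one_of_isHomogeneous hP]
  refine norm_eval_le_polyNorm_two P _ ?_
  rw [Finset.sum_eq_single i (by intro k _ hk; simp [hk]) (by simp)]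
  simp

theorem norm_coeff_mixed_le_two_mul_polyNorm_two {n : ℕ} {P : MvPolynomial (Fin n) ℂ}
    (hP : P.IsHomogeneous 2) {i j : Fin n} (hij : i ≠ j) :
    ‖P.coeff (Finsupp.single i 1 + Finsupp.single j 1)‖ ≤ 2 * polyNorm 2 P := by
  obtain ⟨s, hs⟩ : ∃ s : ℂ, s ^ 2 = 1 / 2 := IsAlgClosed.exists_pow_nat_eq _ two_pos
  have hns : ‖s‖ ^ 2 = 1 / 2 := by rw [← norm_pow, hs]; simp
  have h := eval_two_point_sub_eval_two_point hP hij s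
  rw [hs, mul_one_div_cancel two_ne_zero, one_mul] at h
  rw [← h, two_mul]
  refine (norm_sub_le _ _).trans (add_le_add ?_ ?_) <;>
    refine norm_eval_le_polyNorm_two P _ ?_ <;>
    rw [sum_norm_sq_two_point hij] <;> simp only [norm_neg, hns] <;> norm_num

theorem exists_single_add_of_degree_eq_succ {σ : Type*} {d : σ →₀ ℕ} {m : ℕ}
    (hd : d.degree = m + 1) : ∃ i e, d = Finsupp.single i 1 + e ∧ e.degree = m := by
  obtain ⟨i, hi⟩ : ∃ i, d i ≠ 0 := by
    by_contra! h
    simp [show d = 0 from Finsupp.ext h] at hd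
  obtain ⟨e, rfl⟩ : ∃ e, d = Finsupp.single i 1 + e :=
    exists_add_of_le (Finsupp.single_le_iff.2 (Nat.one_le_iff_ne_zero.2 hi))
  refine ⟨i, e, rfl, ?_⟩
  rw [map_add, Finsupp.degree_single] at hd
  omega

theorem complex_HL_two_homogeneous_on_ell_two
    (n : ℕ) (hn : 0 < n)
    (P : MvPolynomial (Fin n) ℂ) (hP : P.IsHomogeneous 2)
    (α : Fin n →₀ ℕ) (hα : (∑ i ∈ α.support, α i) = 2) :
    ‖MvPolynomial.coeff α P‖ ≤ 4 / Real.sqrt Real.pi * polyNorm 2 P := by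
  have hnonneg : 0 ≤ polyNorm 2 P :=
    (norm_nonneg _).trans (norm_coeff_single_le_polyNorm_two hP ⟨0, hn⟩)
  have hconst : 2 ≤ 4 / Real.sqrt Real.pi := by
    rw [le_div_iff₀ (Real.sqrt_pos.2 Real.pi_pos)]
    have : Real.sqrt Real.pi ≤ 2 := Real.sqrt_le_iff.2 ⟨by norm_num, by linarith [Real.pi_le_four]⟩
    linarith
  refine le_trans ?_ (mul_le_mul_of_nonneg_right hconst hnonneg)
  obtain ⟨i, β, rfl, hβ⟩ := exists_single_add_of_degree_eq_succ hα
  obtain ⟨j, γ, rfl, hγ⟩ := exists_single_add_of_degree_eq_succ hβ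
  rw [(Finsupp.degree_eq_zero_iff γ).1 hγ, add_zero]
  by_cases hij : i = j
  · subst hij
    rw [← Finsupp.single_add]
    exact (norm_coeff_single_le_polyNorm_two hP i).trans (by linarith)
  · exact norm_coeff_mixed_le_two_mul_polyNorm_two hP hij
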